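/- Let (G,w) be an energy game and let f be an energy function with f(x) ≤ e*_{G,w}(x) for every node x. Then for every node u ∈ V_A, min_{(u,v) ∈ E} (f(v) − w(u,v)) ≤ e*_{G,w}(u), and for every node u ∈ V_B, max_{(u,v) ∈ E} (f(v) − w(u,v)) ≤ e*_{G,w}(u). -/

import Mathlib

/-!
Common definitions for energy games (Brim et al. style), following the paper's
definitions: a game graph is a finite directed graph in which every node has
out-degree at least one, together with a partition of the nodes into Alice's
nodes `VA` and Bob's nodes (the complement of `VA`).  Strategies are positional.
For a fixed pair of strategies the play from a node `s` is the orbit of the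
induced successor function, and the minimal sufficient energy at `s` is the
least initial energy that keeps the running energy nonnegative forever, i.e.
`⨆ i, (-(weight of the length-i prefix))⁺ ∈ ℕ∞`; this coincides with
`∞` when the reachable cycle is negative and with `max (0, -min_P w(P))`
(minimum over simple paths `P` from `s`) otherwise.
-/

open scoped BigOperators

universe u

structure GameGraph (V : Type u) [Fintype V] [DecidableEq V] where
  E : Finset (V × V)
  VA : Finset V
  exists_succ : ∀ v : V, ∃ u : V, (v, u) ∈ E

namespace GameGraph

variable {V : Type u} [Fintype V] [DecidableEq V]

/-- Positional strategies of Alice: a choice of an out-edge at every node of Alice. -/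
def AliceStrategy (G : GameGraph V) : Type u :=
  {σ : V → V // ∀ u ∈ G.VA, (u, σ u) ∈ G.E}

/-- Positional strategies of Bob: a choice of an out-edge at every node of Bob. -/
def BobStrategy (G : GameGraph V) : Type u :=
  {τ : V → V // ∀ u : V, u ∉ G.VA → (u, τ u) ∈ G.E}

/-- The successor function of `G(σ,τ)`, the graph in which every node keeps only the
out-edge chosen by its owner's strategy. -/
def play (G : GameGraph V) (σ : G.AliceStrategy) (τ : G.BobStrategy) (v : V) : V :=
  if v ∈ G.VA then σ.1 v else τ.1 v

/-- Total weight of the length-`i` prefix of the unique path from `s` in the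
functional graph with successor function `f`. -/
def prefixWeight (w : V → V → ℤ) (f : V → V) (s : V) (i : ℕ) : ℤ :=
  ∑ j ∈ Finset.range i, w (f^[j] s) (f^[j + 1] s)

/-- The minimal sufficient energy `e*_{G(σ,τ),w}(s)` at `s` for a fixed pair of
strategies with induced successor function `f`:  the least initial energy
(in `ℕ∞ = ℤ≥0 ∪ {∞}`) keeping the running energy nonnegative forever.  It is `∞`
iff the unique cycle reachable from `s` is negative, and `max (0, -min_P w(P))`
(minimum over simple paths from `s`) otherwise. -/
noncomputable def stratEnergy (w : V → V → ℤ) (f : V → V) (s : V) : ℕ∞ :=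
  ⨆ i : ℕ, ((-(prefixWeight w f s i)).toNat : ℕ∞)

/-- The minimal sufficient energy `e*_{G,w}(s) = min_σ max_τ e*_{G(σ,τ),w}(s)`. -/
noncomputable def minEnergy (G : GameGraph V) (w : V → V → ℤ) (s : V) : ℕ∞ :=
  ⨅ σ : G.AliceStrategy, ⨆ τ : G.BobStrategy, stratEnergy w (G.play σ τ) s

/-- Alice wins at `s` iff the minimal sufficient energy at `s` is finite. -/
noncomputable def AliceWins (G : GameGraph V) (w : V → V → ℤ) (s : V) : Prop :=
  G.minEnergy w s ≠ ⊤

/-- The canonical embedding `ℕ∞ = ℤ≥0 ∪ {∞} → ℤ ∪ {∞}` (extended arithmetic: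
`∞ + x = ∞`, `∞ ≥ x`). -/
def toZInf (x : ℕ∞) : WithTop ℤ :=
  if x = ⊤ then ⊤ else ((x.toNat : ℤ) : WithTop ℤ)

/-- `max (x - z, 0)` for `x : ℕ∞` and `z : ℤ`, with `∞ - z = ∞`. -/
def esub (x : ℕ∞) (z : ℤ) : ℕ∞ :=
  if x = ⊤ then ⊤ else ((((x.toNat : ℤ) - z).toNat : ℕ) : ℕ∞)

/-- The successors of `u` in `G`. -/
def succs (G : GameGraph V) (u : V) : Finset V :=
  (G.E.filter (fun p => p.1 = u)).image Prod.snd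

/-- The weight function with every weight rounded up to the nearest multiple of `B`:
`w_B(u,v) = ⌈w(u,v)/B⌉·B`. -/
def roundW (w : V → V → ℤ) (B : ℤ) : V → V → ℤ :=
  fun u v => ⌈(w u v : ℚ) / (B : ℚ)⌉ * B

/-- `W = max_{(u,v) ∈ E} |w(u,v)|`. -/
def maxAbsW (G : GameGraph V) (w : V → V → ℤ) : ℕ :=
  G.E.sup (fun p => (w p.1 p.2).natAbs)

/-- A strategy `τ` of Bob is optimal if `e*_{G(σ,τ),w}(s) ≥ e*_{G,w}(s)` for every
node `s` and every strategy `σ` of Alice. -/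
noncomputable def IsOptimalBob (G : GameGraph V) (w : V → V → ℤ) (τ : G.BobStrategy) : Prop :=
  ∀ (s : V) (σ : G.AliceStrategy), G.minEnergy w s ≤ stratEnergy w (G.play σ τ) s

/-- Total weight of the cycle of length `L` through `x` in the functional graph `f`. -/
def cycleWeight (w : V → V → ℤ) (f : V → V) (x : V) (L : ℕ) : ℤ :=
  ∑ j ∈ Finset.range L, w (f^[j] x) (f^[j + 1] x)

/-- A node `s` has penalty at least `D ≥ 0` if there is an optimal strategy `τ*` of Bob
such that for every strategy `σ` of Alice the unique cycle `C` reachable from `s` in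
`G(σ,τ*)` satisfies: if `w(C) < 0` then the average weight `w(C)/|C|` is at most `-D`.
(The cycle is described by any node `x` on it, reachable from `s`, together with its
minimal period `L`.) -/
noncomputable def HasPenaltyAtLeast (G : GameGraph V) (w : V → V → ℤ) (s : V) (D : ℝ) : Prop :=
  ∃ τ : G.BobStrategy, G.IsOptimalBob w τ ∧
    ∀ σ : G.AliceStrategy, ∀ x : V, (∃ i : ℕ, (G.play σ τ)^[i] s = x) →
      ∀ L : ℕ, 0 < L → (G.play σ τ)^[L] x = x →
        (∀ k : ℕ, 0 < k → k < L → (G.play σ τ)^[k] x ≠ x) →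
        cycleWeight w (G.play σ τ) x L < 0 →
        ((cycleWeight w (G.play σ τ) x L : ℝ) / (L : ℝ) ≤ -D)

end GameGraph

namespace GameGraph

variable {V : Type u} [Fintype V] [DecidableEq V]

theorem stratEnergy_le_iff {X : Type*} (w : X → X → ℤ) (f : X → X) (s : X) (N : ℕ) :
    stratEnergy w f s ≤ N ↔ ∀ i, -(prefixWeight w f s i) ≤ N := by
  simp only [stratEnergy, iSup_le_iff, Nat.cast_le, Int.toNat_le]

theorem prefixWeight_add {X : Type*} (w : X → X → ℤ) (f : X → X) (s : X) (i j : ℕ) :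
    prefixWeight w f s (i + j) = prefixWeight w f s i + prefixWeight w f (f^[i] s) j := by
  simp only [prefixWeight, Finset.sum_range_add, ← Function.iterate_add_apply]
  congr 1
  refine Finset.sum_congr rfl fun k _ => ?_
  rw [Nat.add_comm i k, Nat.add_right_comm k i 1]

theorem prefixWeight_one_add {X : Type*} (w : X → X → ℤ) (f : X → X) (s : X) (i : ℕ) :
    prefixWeight w f s (1 + i) = w s (f s) + prefixWeight w f (f s) i := by
  rw [prefixWeight_add]
  simp [prefixWeight]

theorem prefixWeight_mul_of_iterate_eq {X : Type*} (w : X → X → ℤ) (f : X → X) (s : X) (L : ℕ)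
    (hL : f^[L] s = s) (n : ℕ) :
    prefixWeight w f s (n * L) = n * prefixWeight w f s L := by
  induction n with
  | zero => simp [prefixWeight]
  | succ n ih =>
    rw [Nat.succ_mul, Nat.add_comm, prefixWeight_add, hL, ih]
    push_cast
    ring

/-- A closed walk has nonnegative weight when the prefix weights are bounded below. -/
theorem prefixWeight_nonneg_of_iterate_eq {X : Type*} (w : X → X → ℤ) (f : X → X) (s : X) (L N : ℕ)
    (hL : f^[L] s = s) (hN : ∀ i, -(prefixWeight w f s i) ≤ N) :
    0 ≤ prefixWeight w f s L := by
  by_contra! h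
  have hN' := hN ((N + 1) * L)
  rw [prefixWeight_mul_of_iterate_eq w f s L hL] at hN'
  push_cast at hN'
  nlinarith

theorem iterate_eq_of_avoid {X : Type*} {f g : X → X} {u : X} (hfg : ∀ x, x ≠ u → f x = g x)
    {s : X} {k : ℕ} (hk : ∀ j < k, f^[j] s ≠ u) {j : ℕ} (hj : j ≤ k) : f^[j] s = g^[j] s := by
  induction j with
  | zero => rfl
  | succ j ih =>
    rw [Function.iterate_succ_apply', Function.iterate_succ_apply', ← ih (by omega),
      hfg _ (hk j (by omega))]

theorem prefixWeight_eq_of_avoid {X : Type*} (w : X → X → ℤ) {f g : X → X} {u : X}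
    (hfg : ∀ x, x ≠ u → f x = g x) {s : X} {k : ℕ} (hk : ∀ j < k, f^[j] s ≠ u) :
    prefixWeight w f s k = prefixWeight w g s k := by
  refine Finset.sum_congr rfl fun j hj => ?_
  have hj := Finset.mem_range.1 hj
  rw [iterate_eq_of_avoid hfg hk hj.le, iterate_eq_of_avoid hfg hk hj]

/-- If `f` and `g` agree off `u` and energy `N` suffices at `u` for both, then energy
`N + w u (g u)` suffices for `f` at the `g`-successor of `u`. -/
theorem neg_prefixWeight_le_of_eq_off {X : Type*} (w : X → X → ℤ) {f g : X → X} {u : X} {N : ℕ}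
    (hfg : ∀ x, x ≠ u → f x = g x) (hf : ∀ i, -(prefixWeight w f u i) ≤ N)
    (hg : ∀ i, -(prefixWeight w g u i) ≤ N) (i : ℕ) :
    -(prefixWeight w f (g u) i) ≤ N + w u (g u) := by
  by_cases h : ∃ k < i, f^[k] (g u) = u
  · classical
    obtain ⟨hki, hku⟩ := Nat.find_spec h
    have hmin : ∀ j < Nat.find h, f^[j] (g u) ≠ u := fun j hj hju =>
      Nat.find_min h hj ⟨hj.trans hki, hju⟩
    generalize Nat.find h = k at hki hku hmin
    have hcycle : g^[1 + k] u = u := by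
      rw [Nat.add_comm, Function.iterate_succ_apply, ← iterate_eq_of_avoid hfg hmin le_rfl, hku]
    have hnonneg := prefixWeight_nonneg_of_iterate_eq w g u (1 + k) N hcycle hg
    rw [prefixWeight_one_add, ← prefixWeight_eq_of_avoid w hfg hmin] at hnonneg
    obtain ⟨m, rfl⟩ := Nat.exists_eq_add_of_le hki.le
    rw [prefixWeight_add, hku]
    linarith [hf m]
  · push Not at h
    have hi := hg (1 + i)
    rw [prefixWeight_one_add, ← prefixWeight_eq_of_avoid w hfg h] at hi
    linarith

theorem exists_strategy_of_minEnergy_eq (G : GameGraph V) (w : V → V → ℤ) {u : V} {N : ℕ}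
    (h : G.minEnergy w u = N) :
    ∃ σ : G.AliceStrategy, ∀ (τ : G.BobStrategy) (i : ℕ),
      -(prefixWeight w (G.play σ τ) u i) ≤ N := by
  have hlt : G.minEnergy w u < ((N + 1 : ℕ) : ℕ∞) := by
    rw [h]
    exact_mod_cast Nat.lt_succ_self N
  obtain ⟨σ, hσ⟩ := iInf_lt_iff.1 hlt
  refine ⟨σ, fun τ => (stratEnergy_le_iff _ _ _ _).1 ?_⟩
  refine (le_iSup (fun τ => stratEnergy w (G.play σ τ) u) τ).trans ?_
  push_cast at hσ
  exact Order.le_of_lt_add_one hσ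

theorem exists_minEnergy_le (G : GameGraph V) (w : V → V → ℤ) {v : V} (σ : G.AliceStrategy)
    {K : ℤ} (h : ∀ (τ : G.BobStrategy) (i : ℕ), -(prefixWeight w (G.play σ τ) v i) ≤ K) :
    ∃ M : ℕ, G.minEnergy w v ≤ M ∧ (M : ℤ) = K := by
  choose τ hτ using G.exists_succ
  have hK : 0 ≤ K := by simpa [prefixWeight] using h ⟨τ, fun x _ => hτ x⟩ 0
  lift K to ℕ using hK
  exact ⟨K, iInf_le_of_le σ <| iSup_le fun τ => (stratEnergy_le_iff _ _ _ _).2 (h τ), rfl⟩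

theorem toZInf_top : toZInf ⊤ = ⊤ := if_pos rfl

theorem toZInf_natCast (n : ℕ) : toZInf n = ((n : ℤ) : WithTop ℤ) := by
  simp [toZInf]

theorem toZInf_add_le {x : ℕ∞} {M N : ℕ} {z : ℤ} (hx : x ≤ M) (hM : (M : ℤ) = N + z) :
    toZInf x + ((-z : ℤ) : WithTop ℤ) ≤ toZInf N := by
  lift x to ℕ using ne_top_of_le_ne_top (ENat.natCast_ne_top M) hx
  have hx : x ≤ M := by exact_mod_cast hx
  rw [toZInf_natCast, toZInf_natCast, ← WithTop.coe_add, WithTop.coe_le_coe]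
  omega

/-- Let `f` be an energy function with `f(x) ≤ e*_{G,w}(x)` for every node `x`.  Then
for every `u ∈ V_A`, `min_{(u,v) ∈ E} (f(v) - w(u,v)) ≤ e*_{G,w}(u)` (i.e. some edge
`(u,v)` has `f(v) - w(u,v) ≤ e*_{G,w}(u)`), and for every `u ∈ V_B`,
`max_{(u,v) ∈ E} (f(v) - w(u,v)) ≤ e*_{G,w}(u)` (i.e. every edge `(u,v)` has
`f(v) - w(u,v) ≤ e*_{G,w}(u)`).  Inequalities are taken in `ℤ ∪ {∞}`. -/
theorem update_below_minimal_energy (G : GameGraph V) (w : V → V → ℤ)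
    (f : V → ℕ∞) (hf : ∀ x : V, f x ≤ G.minEnergy w x) (u : V) :
    (u ∈ G.VA → ∃ v : V, (u, v) ∈ G.E ∧
        toZInf (f v) + ((-(w u v) : ℤ) : WithTop ℤ) ≤ toZInf (G.minEnergy w u)) ∧
    (u ∉ G.VA → ∀ v : V, (u, v) ∈ G.E →
        toZInf (f v) + ((-(w u v) : ℤ) : WithTop ℤ) ≤ toZInf (G.minEnergy w u)) := by
  cases hu : G.minEnergy w u with
  | top =>
    simp only [toZInf_top, le_top, and_true, implies_true]
    exact fun _ => G.exists_succ u
  | coe N =>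
    obtain ⟨σ, hσ⟩ := G.exists_strategy_of_minEnergy_eq w hu
    constructor
    · intro huA
      obtain ⟨M, hM, hMN⟩ := G.exists_minEnergy_le w (v := σ.1 u) σ (K := N + w u (σ.1 u)) (by
        intro τ i
        have hi := hσ τ (1 + i)
        rw [prefixWeight_one_add, show G.play σ τ u = σ.1 u from if_pos huA] at hi
        linarith)
      exact ⟨σ.1 u, σ.2 u huA, toZInf_add_le ((hf _).trans hM) hMN⟩
    · intro huB v huv
      obtain ⟨M, hM, hMN⟩ := G.exists_minEnergy_le w (v := v) σ (K := N + w u v) (by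
        intro τ
        let τ' : G.BobStrategy := ⟨Function.update τ.1 u v, fun x hx => by
          by_cases hxu : x = u
          · subst hxu
            simpa using huv
          · simpa [hxu] using τ.2 x hx⟩
        have hτ' : G.play σ τ' u = v := by simp [play, huB, τ']
        have heq : ∀ x, x ≠ u → G.play σ τ x = G.play σ τ' x := by
          intro x hx
          simp [play, τ', hx]
        have hbound := neg_prefixWeight_le_of_eq_off w heq (hσ τ) (hσ τ')
        rwa [hτ'] at hbound)
      exact toZInf_add_le ((hf _).trans hM) hMN

end GameGraph
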